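/- Let V_1, ..., V_k be finite-dimensional vector spaces over F_q, and for each i let G_i ≤ GL(V_i) be a group containing the scalars Z = F_q^× and with (|G_i|, q) = 1. Let G = G_1 ⊗ ... ⊗ G_k act on V = V_1 ⊗ ... ⊗ V_k. If g = g_1 ⊗ ... ⊗ g_k with g_i not a scalar for some i, then either Supp_V(g) ≥ MinSupp_{V_i}(G_i) · dim(V)/dim(V_i) or Supp_V(g) ≥ dim(V)/2. -/

import Mathlib

open TensorProduct in
/-- A tensor product over `Fin k` splits off any one factor, compatibly with maps of factors. -/
theorem PiTensorProduct.exists_splitFactor {K : Type*} [Field K] {k : ℕ}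
    (V : Fin k → Type*) [∀ i, AddCommGroup (V i)] [∀ i, Module K (V i)] (i₀ : Fin k) :
    ∃ e : PiTensorProduct K V ≃ₗ[K]
        V i₀ ⊗[K] PiTensorProduct K (fun i : {i // i ≠ i₀} => V i),
      ∀ f : ∀ i, V i →ₗ[K] V i,
        e.toLinearMap ∘ₗ PiTensorProduct.map f =
          TensorProduct.map (f i₀)
            (PiTensorProduct.map fun i : {i // i ≠ i₀} => f i) ∘ₗ e.toLinearMap := by
  let σ : Fin k ≃ {i // i = i₀} ⊕ {i // i ≠ i₀} := (Equiv.sumCompl (· = i₀)).symm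
  let e₁ := PiTensorProduct.reindex K V σ
  let e₂ := (PiTensorProduct.tmulEquivDep K (fun j => V (σ.symm j))).symm
  let e₃ := TensorProduct.congr
    (PiTensorProduct.subsingletonEquiv (R := K)
      (s := fun j : {i // i = i₀} => V (σ.symm (Sum.inl j))) ⟨i₀, rfl⟩)
    (LinearEquiv.refl K (PiTensorProduct K (fun i : {i // i ≠ i₀} => V (σ.symm (Sum.inr i)))))
  have key : ∀ v : ∀ i, V i, (e₁ ≪≫ₗ e₂ ≪≫ₗ e₃) (PiTensorProduct.tprod K v) =
      (show V i₀ from v i₀) ⊗ₜ[K] PiTensorProduct.tprod K (fun i : {i // i ≠ i₀} => v i) := by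
    intro v
    simp only [LinearEquiv.trans_apply, e₁, e₂, e₃]
    rw [PiTensorProduct.reindex_tprod, PiTensorProduct.tmulEquivDep_symm_apply]
    rw [TensorProduct.congr_tmul, PiTensorProduct.subsingletonEquiv_apply_tprod]
    rfl
  refine ⟨e₁ ≪≫ₗ e₂ ≪≫ₗ e₃, fun f => ?_⟩
  ext v
  have h1 := key v
  have h2 := key (fun i => f i (v i))
  simp only [LinearMap.compMultilinearMap_apply, LinearMap.comp_apply, LinearEquiv.coe_coe,
    PiTensorProduct.map_tprod]
  refine h2.trans ?_
  refine Eq.trans ?_ (congrArg _ h1).symm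
  rw [TensorProduct.map_tmul, PiTensorProduct.map_tprod]

section Intertwiners

variable {K V U : Type*} [Field K] [AddCommGroup V] [Module K V] [AddCommGroup U] [Module K U]

/-- The linear maps `X` with `A X = X C`. -/
def intertwiners (A : Module.End K V) (C : Module.End K U) : Submodule K (U →ₗ[K] V) where
  carrier := {X | A ∘ₗ X = X ∘ₗ C}
  add_mem' {X Y} hX hY := by
    simp only [Set.mem_ofPred_eq] at *
    rw [LinearMap.comp_add, LinearMap.add_comp, hX, hY]
  zero_mem' := by simp
  smul_mem' c X hX := by
    simp only [Set.mem_ofPred_eq] at *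
    rw [LinearMap.comp_smul, LinearMap.smul_comp, hX]

theorem mem_intertwiners {A : Module.End K V} {C : Module.End K U} {X : U →ₗ[K] V} :
    X ∈ intertwiners A C ↔ A ∘ₗ X = X ∘ₗ C := Iff.rfl

open Polynomial

theorem aeval_apply_of_mem_intertwiners {A : Module.End K V} {C : Module.End K U}
    {X : U →ₗ[K] V} (hX : X ∈ intertwiners A C) (p : K[X]) (u : U) :
    aeval A p (X u) = X (aeval C p u) := by
  have h : ∀ w, A (X w) = X (C w) := fun w => LinearMap.congr_fun hX w
  induction p using Polynomial.induction_on generalizing u with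
  | C a => simp
  | add p q hp hq => simp [hp, hq]
  | monomial n a ih =>
    have h2 := ih (C u)
    rw [pow_succ, ← mul_assoc, map_mul (aeval A), map_mul (aeval C), aeval_X, aeval_X,
      Module.End.mul_apply, Module.End.mul_apply, h, h2]

theorem exists_irreducible_aeval_apply_eq_zero [FiniteDimensional K U] [Nontrivial U]
    (C : Module.End K U) : ∃ f : K[X], Irreducible f ∧ ∃ u : U, u ≠ 0 ∧ aeval C f u = 0 := by
  have hint : IsIntegral K C := Algebra.IsIntegral.isIntegral C
  obtain ⟨f, hf, h, hfh⟩ := WfDvdMonoid.exists_irreducible_factor (minpoly.not_isUnit K C)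
    (minpoly.ne_zero hint)
  have hne : aeval C h ≠ 0 := by
    intro h0
    have hdvd := minpoly.dvd K C h0
    rw [hfh] at hdvd
    have hh : h ≠ 0 := by
      rintro rfl
      exact minpoly.ne_zero hint (by rw [hfh, mul_zero])
    exact hf.not_isUnit (isUnit_of_dvd_one
      ((mul_dvd_mul_iff_right hh).1 (by rwa [one_mul])))
  obtain ⟨w, hw⟩ : ∃ w, aeval C h w ≠ 0 := by
    by_contra! hc
    exact hne (LinearMap.ext hc)
  refine ⟨f, hf, aeval C h w, hw, ?_⟩
  rw [← Module.End.mul_apply, ← map_mul, ← hfh, minpoly.aeval, LinearMap.zero_apply]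

/-- The linear map `p ↦ p(C) u`. -/
noncomputable def cyclicMap (C : Module.End K U) (u : U) : K[X] →ₗ[K] U :=
  LinearMap.applyₗ u ∘ₗ (aeval C).toLinearMap

theorem cyclicMap_apply (C : Module.End K U) (u : U) (p : K[X]) :
    cyclicMap C u p = aeval C p u := rfl

theorem natDegree_le_finrank_range_cyclicMap [FiniteDimensional K U] {C : Module.End K U} {u : U}
    {f : K[X]} (hf : Irreducible f) (hu : u ≠ 0) (hfu : aeval C f u = 0) :
    f.natDegree ≤ Module.finrank K (LinearMap.range (cyclicMap C u)) := by
  have hker : LinearMap.ker (cyclicMap C u) = (Ideal.span {f}).restrictScalars K := by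
    ext p
    rw [LinearMap.mem_ker, cyclicMap_apply, Submodule.restrictScalars_mem,
      Ideal.mem_span_singleton]
    constructor
    · intro hp
      by_contra hdvd
      obtain ⟨a, b, hab⟩ := (hf.coprime_iff_not_dvd).2 hdvd
      apply hu
      have := congrArg (fun q => aeval C q u) hab
      simpa [hfu, hp] using this.symm
    · rintro ⟨q, rfl⟩
      rw [mul_comm, map_mul, Module.End.mul_apply, hfu, map_zero]
  rw [← finrank_quotient_span_eq_natDegree (f := f),
    ← (LinearMap.quotKerEquivRange (cyclicMap C u)).finrank_eq, hker]
  exact le_of_eq rfl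

/-- If the kernel of `f(A)` has dimension at most `(m / c) deg f` for every irreducible `f`, then
the intertwiners from `C` to `A` have dimension at most `(m / c) dim U`. -/
theorem mul_finrank_intertwiners_le [FiniteDimensional K V] [FiniteDimensional K U]
    (A : Module.End K V) (C : Module.End K U) (c m : ℕ)
    (hA : ∀ f : K[X], Irreducible f →
      c * Module.finrank K (LinearMap.ker (aeval A f)) ≤ m * f.natDegree) :
    c * Module.finrank K (intertwiners A C) ≤ m * Module.finrank K U := by
  induction hn : Module.finrank K U using Nat.strong_induction_on generalizing U with
  | _ n ih =>
  subst hn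
  rcases subsingleton_or_nontrivial U with hU | hU
  · rw [Module.finrank_zero_of_subsingleton (M := intertwiners A C)]
    simp
  obtain ⟨f, hf, u, hu, hfu⟩ := exists_irreducible_aeval_apply_eq_zero C
  set S := LinearMap.range (cyclicMap C u)
  have hdeg : f.natDegree ≤ Module.finrank K S := natDegree_le_finrank_range_cyclicMap hf hu hfu
  have hSC : S ≤ S.comap C := by
    rintro _ ⟨p, rfl⟩
    exact ⟨X * p, by simp [cyclicMap_apply]⟩
  let r : intertwiners A C →ₗ[K] LinearMap.ker (aeval A f) :=
    LinearMap.codRestrict _ (LinearMap.applyₗ u ∘ₗ (intertwiners A C).subtype) fun X => by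
      change aeval A f (X.1 u) = 0
      rw [aeval_apply_of_mem_intertwiners X.2, hfu, map_zero]
  let j : intertwiners A (S.mapQ S C hSC) →ₗ[K] intertwiners A C :=
    LinearMap.codRestrict _
      (LinearMap.lcomp K V S.mkQ ∘ₗ (intertwiners A (S.mapQ S C hSC)).subtype) fun Y => by
      have hY := fun w => LinearMap.congr_fun (mem_intertwiners.1 Y.2) (S.mkQ w)
      ext w
      exact hY w
  have hker : LinearMap.ker r ≤ LinearMap.range j := by
    intro X hX
    have hXu : X.1 u = 0 := congrArg Subtype.val (LinearMap.mem_ker.1 hX)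
    have hXS : S ≤ LinearMap.ker X.1 := by
      rintro _ ⟨p, rfl⟩
      rw [LinearMap.mem_ker, cyclicMap_apply, ← aeval_apply_of_mem_intertwiners X.2, hXu, map_zero]
    refine ⟨⟨S.liftQ X.1 hXS, ?_⟩, ?_⟩
    · rw [mem_intertwiners]
      ext w
      exact LinearMap.congr_fun (mem_intertwiners.1 X.2) w
    · ext w
      rfl
  have hpos : 0 < f.natDegree := hf.natDegree_pos
  have hq := S.finrank_quotient_add_finrank
  have hi := ih (Module.finrank K (U ⧸ S)) (by omega) (S.mapQ S C hSC) rfl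
  have h1 := LinearMap.finrank_range_add_finrank_ker r
  have h2 := (LinearMap.range r).finrank_le
  have h3 := Submodule.finrank_mono hker
  have h4 := LinearMap.finrank_range_le j
  have h5 := hA f hf
  calc c * Module.finrank K (intertwiners A C)
      ≤ c * (Module.finrank K (LinearMap.ker (aeval A f)) +
          Module.finrank K (intertwiners A (S.mapQ S C hSC))) :=
        Nat.mul_le_mul_left _ (by omega)
    _ ≤ m * f.natDegree + m * Module.finrank K (U ⧸ S) := by rw [mul_add]; omega
    _ ≤ m * Module.finrank K U := by
        rw [← mul_add]
        exact Nat.mul_le_mul_left _ (by omega)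

/-- It is enough to bound the geometric multiplicities. -/
theorem two_mul_finrank_intertwiners_le [FiniteDimensional K V] [FiniteDimensional K U]
    (A : Module.End K V) (C : Module.End K U) (m : ℕ) (hm : Module.finrank K V ≤ m)
    (hA : ∀ a : K, 2 * Module.finrank K (LinearMap.ker (A - a • LinearMap.id)) ≤ m) :
    2 * Module.finrank K (intertwiners A C) ≤ m * Module.finrank K U := by
  refine mul_finrank_intertwiners_le A C 2 m fun f hf => ?_
  have hpos : 0 < f.natDegree := hf.natDegree_pos
  rcases Nat.lt_or_ge f.natDegree 2 with h | h
  · have h1 : f.natDegree = 1 := by omega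
    obtain ⟨a, ha, b, rfl⟩ := Polynomial.natDegree_eq_one.1 h1
    rw [h1, mul_one]
    suffices hker : LinearMap.ker (aeval A (Polynomial.C a * X + Polynomial.C b)) =
        LinearMap.ker (A - (-(a⁻¹ * b)) • LinearMap.id) by
      rw [hker]
      exact hA _
    ext v
    simp only [LinearMap.mem_ker, map_add, map_mul, aeval_C, aeval_X, LinearMap.add_apply,
      Module.End.mul_apply, Module.algebraMap_end_apply, LinearMap.smul_apply,
      LinearMap.id_apply, neg_smul, sub_neg_eq_add]
    rw [← smul_eq_zero_iff_right (inv_ne_zero ha), smul_add, smul_smul, smul_smul,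
      inv_mul_cancel₀ ha, one_smul]
  · have h1 := (LinearMap.ker (aeval A f)).finrank_le
    calc 2 * Module.finrank K (LinearMap.ker (aeval A f)) ≤ 2 * m := by omega
      _ ≤ m * f.natDegree := by rw [mul_comm]; exact Nat.mul_le_mul_left _ h

open TensorProduct in
/-- Fixed vectors of `A ⊗ B` embed into the intertwiners from the dual of `B` to the inverse
of `A`. -/
theorem finrank_ker_map_sub_id_le {W : Type*} [AddCommGroup W] [Module K W]
    [FiniteDimensional K V] [FiniteDimensional K W]
    (A A' : Module.End K V) (hA : A' * A = 1) (B : Module.End K W) :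
    Module.finrank K (LinearMap.ker (TensorProduct.map A B - LinearMap.id)) ≤
      Module.finrank K (intertwiners A' (B.dualMap : Module.End K (Module.Dual K W))) := by
  let e : V ⊗[K] W ≃ₗ[K] (Module.Dual K W →ₗ[K] V) :=
    TensorProduct.comm K V W ≪≫ₗ
      TensorProduct.congr (Module.evalEquiv K W) (LinearEquiv.refl K V) ≪≫ₗ
        dualTensorHomEquiv K (Module.Dual K W) V
  have he : ∀ (v : V) (w : W) (φ : Module.Dual K W), e (v ⊗ₜ w) φ = φ w • v := by
    intro v w φ
    simp [e]
  clear_value e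
  have hconj : ∀ t, e (TensorProduct.map A B t) = A ∘ₗ e t ∘ₗ B.dualMap := by
    intro t
    induction t with
    | zero => simp
    | add x y hx hy => simp only [map_add, hx, hy, LinearMap.add_comp, LinearMap.comp_add]
    | tmul v w =>
      ext φ
      simp [he]
  have hA' : ∀ v, A' (A v) = v := fun v => LinearMap.congr_fun hA v
  have hmem : ∀ t ∈ LinearMap.ker (TensorProduct.map A B - LinearMap.id),
      e.toLinearMap t ∈ intertwiners A' (B.dualMap : Module.End K (Module.Dual K W)) := by
    intro t ht
    have ht' : TensorProduct.map A B t = t := sub_eq_zero.1 ht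
    have h1 := hconj t
    rw [ht'] at h1
    rw [mem_intertwiners]
    ext φ
    have h2 := LinearMap.congr_fun h1 φ
    simp only [LinearMap.comp_apply, LinearEquiv.coe_coe] at h2 ⊢
    rw [h2, hA']
  refine LinearMap.finrank_le_finrank_of_injective (f := e.toLinearMap.restrict hmem) ?_
  intro x y hxy
  have hval : e x.1 = e y.1 := congrArg Subtype.val hxy
  exact Subtype.ext (e.injective hval)

end Intertwiners


/- STATEMENT 5: Tensor products. G_i ≤ GL(V_i) contain the scalars and are coprime to q.
If g = g_1 ⊗ ... ⊗ g_k with some g_{i₀} non-scalar, then either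
Supp_V(g)·dim(V_{i₀}) ≥ MinSupp_{V_{i₀}}(G_{i₀})·dim(V) or 2·Supp_V(g) ≥ dim(V),
where V = V_1 ⊗ ... ⊗ V_k. -/
theorem supp_tensor_lower_bound {K : Type*} [Field K] [Fintype K] {k : ℕ}
    (V : Fin k → Type*) [∀ i, AddCommGroup (V i)] [∀ i, Module K (V i)]
    [∀ i, FiniteDimensional K (V i)]
    (G : ∀ i, Subgroup (LinearMap.GeneralLinearGroup K (V i)))
    (hZ : ∀ (i : Fin k) (z : Kˣ), ∃ u ∈ G i, ((u : V i →ₗ[K] V i) = (z : K) • LinearMap.id))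
    (hcop : ∀ i, Nat.Coprime (Nat.card (G i)) (Fintype.card K))
    (g : ∀ i, LinearMap.GeneralLinearGroup K (V i)) (hg : ∀ i, g i ∈ G i)
    (i₀ : Fin k) (hns : ¬ ∃ z : K, ((g i₀ : V i₀ →ₗ[K] V i₀) = z • LinearMap.id)) :
    (Module.finrank K (PiTensorProduct K V) -
        Module.finrank K (LinearMap.ker
          (PiTensorProduct.map (fun i => (g i : V i →ₗ[K] V i)) - LinearMap.id)))
        * Module.finrank K (V i₀) ≥
      sInf {s : ℕ | ∃ u ∈ G i₀, u ≠ 1 ∧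
          s = Module.finrank K (V i₀) -
            Module.finrank K (LinearMap.ker ((u : V i₀ →ₗ[K] V i₀) - LinearMap.id))}
        * Module.finrank K (PiTensorProduct K V)
    ∨ 2 * (Module.finrank K (PiTensorProduct K V) -
        Module.finrank K (LinearMap.ker
          (PiTensorProduct.map (fun i => (g i : V i →ₗ[K] V i)) - LinearMap.id)))
      ≥ Module.finrank K (PiTensorProduct K V) := by
  obtain ⟨e, he⟩ := PiTensorProduct.exists_splitFactor (K := K) V i₀
  set W := PiTensorProduct K (fun i : {i // i ≠ i₀} => V i)
  set B : Module.End K W :=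
    PiTensorProduct.map fun i : {i // i ≠ i₀} => (g i : V i →ₗ[K] V i)
  set T : Module.End K (PiTensorProduct K V) :=
    PiTensorProduct.map fun i => (g i : V i →ₗ[K] V i)
  set M := sInf {s : ℕ | ∃ u ∈ G i₀, u ≠ 1 ∧
          s = Module.finrank K (V i₀) -
            Module.finrank K (LinearMap.ker ((u : V i₀ →ₗ[K] V i₀) - LinearMap.id))}
  set n := Module.finrank K (V i₀)
  have hdim : Module.finrank K (PiTensorProduct K V) = n * Module.finrank K W := by
    rw [e.finrank_eq, Module.finrank_tensorProduct]
  have hfix : Module.finrank K (LinearMap.ker (T - LinearMap.id)) ≤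
      Module.finrank K (LinearMap.ker
        (TensorProduct.map (g i₀ : V i₀ →ₗ[K] V i₀) B - LinearMap.id)) := by
    have hmem : ∀ t ∈ LinearMap.ker (T - LinearMap.id), e.toLinearMap t ∈ LinearMap.ker
        (TensorProduct.map (g i₀ : V i₀ →ₗ[K] V i₀) B - LinearMap.id) := by
      intro t ht
      have ht' : T t = t := sub_eq_zero.1 ht
      have h1 := LinearMap.congr_fun (he fun i => (g i : V i →ₗ[K] V i)) t
      refine sub_eq_zero.2 (h1.symm.trans ?_)
      exact congrArg e ht'
    refine LinearMap.finrank_le_finrank_of_injective (f := e.toLinearMap.restrict hmem) ?_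
    intro x y hxy
    exact Subtype.ext (e.injective (congrArg Subtype.val hxy))
  have hinv : ((g i₀)⁻¹ : LinearMap.GeneralLinearGroup K (V i₀)).1 * (g i₀).1 = 1 :=
    Units.inv_mul _
  have hinv' : (g i₀).1 * ((g i₀)⁻¹ : LinearMap.GeneralLinearGroup K (V i₀)).1 = 1 :=
    Units.mul_inv _
  set A' : Module.End K (V i₀) := ((g i₀)⁻¹ : LinearMap.GeneralLinearGroup K (V i₀)).1
  have hmult : ∀ a : K, M + Module.finrank K (LinearMap.ker (A' - a • LinearMap.id)) ≤ n := by
    intro a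
    have hnscalar : ∀ b : K, A' ≠ b • LinearMap.id := by
      intro b hb
      rcases eq_or_ne b 0 with rfl | hb0
      · refine hns ⟨0, ?_⟩
        rw [zero_smul] at hb ⊢
        rw [← mul_one ((g i₀).1), ← hinv, hb, zero_mul, mul_zero]
      · refine hns ⟨b⁻¹, ?_⟩
        rw [hb] at hinv
        have : b • (g i₀).1 = 1 := by
          rw [← hinv]; ext v; simp
        rw [← one_smul K ((g i₀).1), ← inv_mul_cancel₀ hb0, mul_smul, this]
        rfl
    have hle : ∀ u ∈ G i₀, u ≠ 1 →
        M + Module.finrank K (LinearMap.ker ((u : V i₀ →ₗ[K] V i₀) - LinearMap.id)) ≤ n := by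
      intro u hu hu1
      have h1 : M ≤ n - Module.finrank K
          (LinearMap.ker ((u : V i₀ →ₗ[K] V i₀) - LinearMap.id)) :=
        Nat.sInf_le ⟨u, hu, hu1, rfl⟩
      have h2 := (LinearMap.ker ((u : V i₀ →ₗ[K] V i₀) - LinearMap.id)).finrank_le
      omega
    rcases eq_or_ne a 0 with rfl | ha
    · have hker : LinearMap.ker (A' - (0 : K) • LinearMap.id) = ⊥ := by
        rw [zero_smul, sub_zero, LinearMap.ker_eq_bot']
        intro v hv
        have := LinearMap.congr_fun hinv' v
        simpa [hv] using this.symm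
      rw [hker, finrank_bot]
      have h1 := hle (g i₀) (hg i₀) fun h => hns ⟨1, by rw [h, one_smul]; rfl⟩
      omega
    · obtain ⟨z, hz, hzeq⟩ := hZ i₀ (Units.mk0 a ha)⁻¹
      have hval : ((z * (g i₀)⁻¹ : LinearMap.GeneralLinearGroup K (V i₀)) :
          V i₀ →ₗ[K] V i₀) = a⁻¹ • A' := by
        change z.1 * A' = _
        rw [show z.1 = _ from hzeq]
        ext v
        simp
      have h1 := hle (z * (g i₀)⁻¹) (mul_mem hz (inv_mem (hg i₀))) fun h => by
        rw [h] at hval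
        apply hnscalar a
        rw [← one_smul K A', ← mul_inv_cancel₀ ha, mul_smul, ← hval]
        rfl
      rw [hval] at h1
      have hker : LinearMap.ker (A' - a • LinearMap.id) =
          LinearMap.ker (a⁻¹ • A' - LinearMap.id) := by
        rw [← LinearMap.ker_smul (a⁻¹ • A' - LinearMap.id) a ha, smul_sub, smul_smul,
          mul_inv_cancel₀ ha, one_smul]
      rwa [hker]
  have hMn : M ≤ n := le_trans (Nat.le_add_right _ _) (hmult 0)
  have hbound := two_mul_finrank_intertwiners_le A'
    (B.dualMap : Module.End K (Module.Dual K W)) (max (2 * (n - M)) n) (le_max_right _ _)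
    fun a => le_trans (by have := hmult a; omega) (le_max_left _ _)
  have hemb := finrank_ker_map_sub_id_le (g i₀).1 A' hinv B
  rw [Subspace.dual_finrank_eq] at hbound
  set F := Module.finrank K (LinearMap.ker (T - LinearMap.id))
  set w := Module.finrank K W
  have hF := Nat.mul_le_mul_left 2 (hfix.trans hemb)
  rw [hdim]
  rcases le_total (2 * (n - M)) n with hcase | hcase
  · right
    rw [max_eq_right hcase] at hbound
    omega
  · left
    rw [max_eq_left hcase, mul_assoc] at hbound
    have h1 : F ≤ (n - M) * w := by omega
    have h2 : M * w ≤ n * w - F := by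
      have : n * w = M * w + (n - M) * w := by rw [← add_mul, Nat.add_sub_cancel' hMn]
      omega
    calc M * (n * w) = M * w * n := by ring
      _ ≤ (n * w - F) * n := Nat.mul_le_mul_right _ h2
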